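/- arXiv:1906.03162 — 2 statements merged into one kernel-verified Lean document; each statement's English description precedes it below -/
import Mathlib

section
/- For every exceptional vector e ∈ C: there is exactly one f ∈ C with e·f = 3, there are exactly 56 elements f ∈ C with e·f = 0, exactly 126 elements f ∈ C with e·f = 1, and exactly 56 elements f ∈ C with e·f = 2. -/
/-- The bilinear form on `Λ = ℤ⁹`: `d·e = d₀e₀ − Σ_{i=1}^{8} dᵢeᵢ`. -/
def dot (d e : Fin 9 → ℤ) : ℤ := d 0 * e 0 - ∑ i : Fin 8, d i.succ * e i.succ

/-- The canonical class `K = (−3, 1, 1, 1, 1, 1, 1, 1, 1)`. -/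
def KK : Fin 9 → ℤ := ![-3, 1, 1, 1, 1, 1, 1, 1, 1]

/-- A vector is exceptional if `d·d = −1` and `d·K = −1`. -/
def IsExceptional (d : Fin 9 → ℤ) : Prop := dot d d = -1 ∧ dot d KK = -1

/-- The integer vectors of length `n` with entries in `[-3, 1]`, coordinate sum `s` and
sum of squares `q`; branches violating the Cauchy–Schwarz inequality are pruned. -/
def sphereSlice : (n : ℕ) → ℤ → ℤ → List (Fin n → ℤ)
  | 0, s, q => if s = 0 ∧ q = 0 then [Fin.elim0] else []
  | n + 1, s, q =>
    [-3, -2, -1, 0, 1].flatMap fun a =>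
      if (s - a) * (s - a) ≤ n * (q - a * a) then
        (sphereSlice n (s - a) (q - a * a)).map (Fin.cons (α := fun _ => ℤ) a)
      else []

/-- An enumeration of the exceptional vectors. -/
def exceptionalList : List (Fin 9 → ℤ) :=
  [-1, 0, 1, 2, 3, 4, 5, 6, 7].flatMap fun m =>
    (sphereSlice 8 (1 - 3 * m) (m * m + 1)).map (Fin.cons (α := fun _ => ℤ) m)

theorem sum_mul_sum_le {n : ℕ} (v : Fin n → ℤ) :
    (∑ i, v i) * (∑ i, v i) ≤ n * ∑ i, v i * v i := by
  simpa [sq] using sq_sum_le_card_mul_sum_sq (s := Finset.univ) (f := v)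

theorem mem_sphereSlice {n : ℕ} {s q : ℤ} (v : Fin n → ℤ) :
    v ∈ sphereSlice n s q ↔
      (∀ i, -3 ≤ v i ∧ v i ≤ 1) ∧ ∑ i, v i = s ∧ ∑ i, v i * v i = q := by
  induction n generalizing s q with
  | zero =>
    have hv : v = Fin.elim0 := Subsingleton.elim _ _
    by_cases h : s = 0 ∧ q = 0
    · simp [sphereSlice, h, hv]
    · simp only [sphereSlice, if_neg h, List.not_mem_nil, Finset.univ_eq_empty,
        Finset.sum_empty, false_iff]
      exact fun h' => h ⟨h'.2.1.symm, h'.2.2.symm⟩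
  | succ n ih =>
    simp only [sphereSlice, List.mem_flatMap, Fin.sum_univ_succ, Fin.forall_fin_succ]
    constructor
    · rintro ⟨a, ha, h⟩
      split_ifs at h
      · obtain ⟨w, hw, rfl⟩ := List.mem_map.1 h
        rw [ih] at hw
        simp only [Fin.cons_zero, Fin.cons_succ, hw]
        refine ⟨⟨?_, fun _ => ⟨trivial, trivial⟩⟩, by ring, by ring⟩
        fin_cases ha <;> norm_num
      · simp at h
    · rintro ⟨⟨⟨hlo, hhi⟩, hb⟩, hs, hq⟩
      have hsum : ∑ i : Fin n, v i.succ = s - v 0 := by linarith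
      have hsq : ∑ i : Fin n, v i.succ * v i.succ = q - v 0 * v 0 := by linarith
      refine ⟨v 0, ?_, ?_⟩
      · generalize v 0 = a at hlo hhi
        interval_cases a <;> simp
      · rw [if_pos (by rw [← hsum, ← hsq]; exact sum_mul_sum_le _), List.mem_map]
        exact ⟨Fin.tail v, (ih _).2 ⟨hb, hsum, hsq⟩, Fin.cons_self_tail v⟩

theorem nodup_flatMap_cons {n : ℕ} {l : List ℤ} (hl : l.Nodup)
    {g : ℤ → List (Fin n → ℤ)} (hg : ∀ a, (g a).Nodup) :
    (l.flatMap fun a => (g a).map (Fin.cons (α := fun _ => ℤ) a)).Nodup := by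
  rw [List.nodup_flatMap]
  refine ⟨fun a _ => (hg a).map (Fin.cons_right_injective (α := fun _ => ℤ) a),
    hl.imp fun {a b} hab => ?_⟩
  intro v ha hb
  obtain ⟨x, -, rfl⟩ := List.mem_map.1 ha
  obtain ⟨y, -, hy⟩ := List.mem_map.1 hb
  exact hab (by simpa using (congrFun hy 0).symm)

theorem nodup_sphereSlice (n : ℕ) (s q : ℤ) : (sphereSlice n s q).Nodup := by
  induction n generalizing s q with
  | zero => rw [sphereSlice]; split_ifs <;> simp
  | succ n ih =>
    have := nodup_flatMap_cons (n := n) (l := [-3, -2, -1, 0, 1])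
      (by decide) (g := fun a => if (s - a) * (s - a) ≤ n * (q - a * a) then
        sphereSlice n (s - a) (q - a * a) else [])
      (fun a => by split_ifs <;> simp [ih])
    simpa only [sphereSlice, apply_ite (List.map _), List.map_nil] using this

theorem nodup_exceptionalList : exceptionalList.Nodup :=
  nodup_flatMap_cons (by decide) fun _ => nodup_sphereSlice _ _ _

theorem isExceptional_iff (d : Fin 9 → ℤ) :
    IsExceptional d ↔ ∑ i : Fin 8, d i.succ = 1 - 3 * d 0 ∧
      ∑ i : Fin 8, d i.succ * d i.succ = d 0 * d 0 + 1 := by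
  have hK : dot d KK = -3 * d 0 - ∑ i : Fin 8, d i.succ := by
    simp [dot, KK, Fin.sum_univ_succ]; ring
  rw [IsExceptional, hK, dot]
  constructor <;> rintro ⟨h1, h2⟩ <;> constructor <;> linarith

theorem IsExceptional.bounds {d : Fin 9 → ℤ} (hd : IsExceptional d) (i : Fin 8) :
    -3 ≤ d i.succ ∧ d i.succ ≤ 1 := by
  obtain ⟨hs, hq⟩ := (isExceptional_iff d).1 hd
  rw [Fin.sum_univ_succAbove _ i] at hs hq
  have hcs := sum_mul_sum_le fun j : Fin 7 => d (i.succAbove j).succ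
  rw [eq_sub_of_add_eq' hs, eq_sub_of_add_eq' hq] at hcs
  push_cast at hcs
  generalize d i.succ = a at hcs
  have h : (a + 3) * (a - 1) ≤ 0 := by nlinarith [sq_nonneg (2 * d 0 + 3 * a - 3)]
  constructor <;> nlinarith

theorem mem_exceptionalList (d : Fin 9 → ℤ) : d ∈ exceptionalList ↔ IsExceptional d := by
  simp only [exceptionalList, List.mem_flatMap, List.mem_map]
  constructor
  · rintro ⟨m, -, w, hw, rfl⟩
    rw [mem_sphereSlice] at hw
    simpa [isExceptional_iff] using hw.2
  · intro hd
    obtain ⟨hs, hq⟩ := (isExceptional_iff d).1 hd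
    have hcs := sum_mul_sum_le fun i : Fin 8 => d i.succ
    rw [hs, hq] at hcs
    have hlo : -1 ≤ d 0 := by push_cast at hcs; nlinarith
    have hhi : d 0 ≤ 7 := by push_cast at hcs; nlinarith
    refine ⟨d 0, ?_, Fin.tail d, (mem_sphereSlice _).2 ⟨hd.bounds, hs, hq⟩,
      Fin.cons_self_tail d⟩
    generalize d 0 = m at hlo hhi
    interval_cases m <;> simp

theorem count_of_sorted : ∀ e ∈ exceptionalList,
    (∀ i : Fin 7, e i.castSucc.succ ≤ e i.succ.succ) →
      exceptionalList.countP (dot e · = 3) = 1 ∧ exceptionalList.countP (dot e · = 0) = 56 ∧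
      exceptionalList.countP (dot e · = 1) = 126 ∧ exceptionalList.countP (dot e · = 2) = 56 := by
  simp only [dot, Fin.sum_univ_eight]
  decide +kernel

theorem ncard_setOf_eq_countP (p : (Fin 9 → ℤ) → Prop) [DecidablePred p] :
    {f | IsExceptional f ∧ p f}.ncard = exceptionalList.countP p := by
  have h : {f | IsExceptional f ∧ p f} = ((exceptionalList.filter p).toFinset : Set _) := by
    ext f
    simp [mem_exceptionalList]
  rw [h, Set.ncard_coe_finset, List.toFinset_card_of_nodup (nodup_exceptionalList.filter _),
    List.countP_eq_length_filter]

/-- The action of a permutation of the last eight coordinates. -/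
def permuteTail (σ : Equiv.Perm (Fin 8)) (d : Fin 9 → ℤ) : Fin 9 → ℤ :=
  Fin.cons (d 0) (Fin.tail d ∘ σ)

theorem dot_permuteTail (σ : Equiv.Perm (Fin 8)) (d e : Fin 9 → ℤ) :
    dot (permuteTail σ d) (permuteTail σ e) = dot d e := by
  simp only [dot, permuteTail, Fin.cons_zero, Fin.cons_succ, Function.comp_apply, Fin.tail]
  rw [Equiv.sum_comp σ fun i => d i.succ * e i.succ]

theorem permuteTail_KK (σ : Equiv.Perm (Fin 8)) : permuteTail σ KK = KK := by
  have h (i : Fin 8) : KK i.succ = 1 := by fin_cases i <;> rfl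
  funext i
  cases i using Fin.cases <;> simp [permuteTail, Fin.tail, h]

theorem isExceptional_permuteTail (σ : Equiv.Perm (Fin 8)) (d : Fin 9 → ℤ) :
    IsExceptional (permuteTail σ d) ↔ IsExceptional d := by
  have h := dot_permuteTail σ d KK
  rw [permuteTail_KK] at h
  rw [IsExceptional, IsExceptional, dot_permuteTail, h]

theorem permuteTail_bijective (σ : Equiv.Perm (Fin 8)) :
    Function.Bijective (permuteTail σ) := by
  refine Function.bijective_iff_has_inverse.2 ⟨permuteTail σ.symm, fun d => ?_, fun d => ?_⟩ <;>
  · funext i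
    cases i using Fin.cases <;> simp [permuteTail, Fin.tail]

theorem ncard_dot_permuteTail (σ : Equiv.Perm (Fin 8)) (e : Fin 9 → ℤ) (k : ℤ) :
    {f | IsExceptional f ∧ dot (permuteTail σ e) f = k}.ncard =
      {f | IsExceptional f ∧ dot e f = k}.ncard := by
  rw [← Set.ncard_preimage_of_injective_subset_range (permuteTail_bijective σ).injective
    (by simp [(permuteTail_bijective σ).surjective.range_eq])]
  simp only [Set.preimage_ofPred_eq, isExceptional_permuteTail, dot_permuteTail]

/-- For every exceptional vector `e`: exactly one `f ∈ C` with `e·f = 3`, exactly 56 with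
`e·f = 0`, exactly 126 with `e·f = 1`, and exactly 56 with `e·f = 2`. -/
theorem stmt_3 (e : Fin 9 → ℤ) (he : IsExceptional e) :
    {f : Fin 9 → ℤ | IsExceptional f ∧ dot e f = 3}.ncard = 1 ∧
    {f : Fin 9 → ℤ | IsExceptional f ∧ dot e f = 0}.ncard = 56 ∧
    {f : Fin 9 → ℤ | IsExceptional f ∧ dot e f = 1}.ncard = 126 ∧
    {f : Fin 9 → ℤ | IsExceptional f ∧ dot e f = 2}.ncard = 56 := by
  obtain ⟨σ, hσ⟩ : ∃ σ : Equiv.Perm (Fin 8), Monotone (Fin.tail e ∘ σ) :=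
    ⟨_, Tuple.monotone_sort _⟩
  simp only [← ncard_dot_permuteTail σ e, ncard_setOf_eq_countP]
  refine count_of_sorted _ ((mem_exceptionalList _).2 ((isExceptional_permuteTail σ e).2 he))
    fun i => ?_
  simpa only [permuteTail, Fin.cons_succ] using hσ i.castSucc_lt_succ.le
end

section
/- For every pair of exceptional vectors e₁, e₂ ∈ C with e₁·e₂ = 2, there is exactly one f ∈ C such that e₁·f = 2 and e₂·f = 2. -/
theorem dot_comm (d e : Fin 9 → ℤ) : dot d e = dot e d := by
  simp only [dot, mul_comm]

theorem dot_add_left (d d' e : Fin 9 → ℤ) : dot (d + d') e = dot d e + dot d' e := by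
  simp only [dot, Pi.add_apply, add_mul, Finset.sum_add_distrib]
  ring

theorem dot_smul_left (c : ℤ) (d e : Fin 9 → ℤ) : dot (c • d) e = c * dot d e := by
  simp only [dot, Pi.smul_apply, smul_eq_mul, mul_assoc, ← Finset.mul_sum]
  ring

theorem dot_add_right (d e e' : Fin 9 → ℤ) : dot d (e + e') = dot d e + dot d e' := by
  simp only [dot_comm d, dot_add_left]

theorem dot_smul_right (c : ℤ) (d e : Fin 9 → ℤ) : dot d (c • e) = c * dot d e := by
  simp only [dot_comm d, dot_smul_left]

theorem dot_KK_right (d : Fin 9 → ℤ) : dot d KK = -3 * d 0 - ∑ i : Fin 8, d i.succ := by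
  simp [dot, KK, Fin.sum_univ_succ]
  ring

theorem dot_KK_KK : dot KK KK = 1 := by
  decide

/-- The form is anisotropic on the orthogonal complement of `K`. -/
theorem eq_zero_of_dot_self_eq_zero {w : Fin 9 → ℤ} (hK : dot w KK = 0) (hw : dot w w = 0) :
    w = 0 := by
  rw [dot_KK_right] at hK
  have hsq : ∑ i : Fin 8, w i.succ ^ 2 = w 0 ^ 2 := by
    simp only [dot, ← pow_two] at hw
    linarith
  have hcs := sq_sum_le_card_mul_sum_sq (s := Finset.univ) (f := fun i : Fin 8 => w i.succ)
  rw [hsq, show ∑ i : Fin 8, w i.succ = -3 * w 0 by linarith] at hcs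
  simp only [Finset.card_univ, Fintype.card_fin, Nat.cast_ofNat] at hcs
  have h0 : w 0 = 0 := by
    rw [← sq_eq_zero_iff]
    nlinarith [sq_nonneg (w 0)]
  rw [h0, zero_pow two_ne_zero, Finset.sum_eq_zero_iff_of_nonneg fun i _ => sq_nonneg _] at hsq
  funext i
  refine Fin.cases h0 (fun j => ?_) i
  simpa using hsq j (Finset.mem_univ j)

/-- For exceptional `e₁, e₂` with `e₁·e₂ = 2` there is exactly one exceptional `f` with
`e₁·f = 2` and `e₂·f = 2`. -/
theorem stmt_4 (e₁ e₂ : Fin 9 → ℤ) (h₁ : IsExceptional e₁) (h₂ : IsExceptional e₂)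
    (h12 : dot e₁ e₂ = 2) :
    ∃! f : Fin 9 → ℤ, IsExceptional f ∧ dot e₁ f = 2 ∧ dot e₂ f = 2 := by
  obtain ⟨h₁s, h₁K⟩ := h₁
  obtain ⟨h₂s, h₂K⟩ := h₂
  have h21 : dot e₂ e₁ = 2 := by rw [dot_comm, h12]
  have hK₁ : dot KK e₁ = -1 := by rw [dot_comm, h₁K]
  have hK₂ : dot KK e₂ = -1 := by rw [dot_comm, h₂K]
  refine ⟨(-1 : ℤ) • e₁ + (-1 : ℤ) • e₂ + (-3 : ℤ) • KK, ⟨⟨?_, ?_⟩, ?_, ?_⟩, ?_⟩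
  · simp only [dot_add_left, dot_add_right, dot_smul_left, dot_smul_right, *, dot_KK_KK]
    norm_num
  · simp only [dot_add_left, dot_smul_left, *, dot_KK_KK]
    norm_num
  · simp only [dot_add_right, dot_smul_right, *]
    norm_num
  · simp only [dot_add_right, dot_smul_right, *]
    norm_num
  · rintro f ⟨⟨hfs, hfK⟩, h1f, h2f⟩
    have hf1 : dot f e₁ = 2 := by rw [dot_comm, h1f]
    have hf2 : dot f e₂ = 2 := by rw [dot_comm, h2f]
    have hKf : dot KK f = -1 := by rw [dot_comm, hfK]
    have hw : f + e₁ + e₂ + (3 : ℤ) • KK = 0 := by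
      apply eq_zero_of_dot_self_eq_zero
      · simp only [dot_add_left, dot_smul_left, *, dot_KK_KK]
        norm_num
      · simp only [dot_add_left, dot_add_right, dot_smul_left, dot_smul_right, *, dot_KK_KK]
        norm_num
    linear_combination hw
end
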